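/- Let n ≥ 1 and let u : ℝⁿ → ℝ be three times continuously differentiable with compact support. Then for any indices i, j ∈ {1, …, n}, ∫_{ℝⁿ} (∂ᵢ∂ⱼ u)² dx = ∫_{ℝⁿ} (∂ᵢ∂ᵢ u)(∂ⱼ∂ⱼ u) dx. -/

import Mathlib

/-- Partial derivative of `f : ℝⁿ → ℝ` in the `i`-th coordinate direction. -/
noncomputable def pderiv' (n : ℕ) (i : Fin n) (f : EuclideanSpace ℝ (Fin n) → ℝ)
    (x : EuclideanSpace ℝ (Fin n)) : ℝ :=
  fderiv ℝ f x (EuclideanSpace.single i 1)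

open MeasureTheory in
theorem pderiv_contDiff_aux (n : ℕ) (i : Fin n) (f : EuclideanSpace ℝ (Fin n) → ℝ) (k m : ℕ)
    (hf : ContDiff ℝ m f) (hkm : k + 1 ≤ m) : ContDiff ℝ k (pderiv' n i f) := by
  have h : ContDiff ℝ k (fderiv ℝ f) := hf.fderiv_right (by exact_mod_cast hkm)
  exact h.clm_apply contDiff_const

theorem pderiv_supp_aux (n : ℕ) (i : Fin n) (f : EuclideanSpace ℝ (Fin n) → ℝ)
    (hf : HasCompactSupport f) : HasCompactSupport (pderiv' n i f) :=
  hf.fderiv_apply (𝕜 := ℝ) _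

theorem pderiv_comm_aux (n : ℕ) (i j : Fin n) (f : EuclideanSpace ℝ (Fin n) → ℝ)
    (hf : ContDiff ℝ 2 f) (x : EuclideanSpace ℝ (Fin n)) :
    pderiv' n i (pderiv' n j f) x = pderiv' n j (pderiv' n i f) x := by
  have hs : IsSymmSndFDerivAt ℝ f x := hf.contDiffAt.isSymmSndFDerivAt (by simp)
  have hd : DifferentiableAt ℝ (fderiv ℝ f) x :=
    ((hf.fderiv_right (m := 1) (by norm_num)).differentiable (by norm_num)) x
  have key : ∀ a b : Fin n, pderiv' n a (pderiv' n b f) x =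
      fderiv ℝ (fderiv ℝ f) x (EuclideanSpace.single a 1) (EuclideanSpace.single b 1) := by
    intro a b
    change fderiv ℝ (fun y => fderiv ℝ f y (EuclideanSpace.single b 1)) x _ = _
    rw [fderiv_clm_apply hd (by fun_prop)]
    simp
  rw [key, key]
  exact hs _ _

open MeasureTheory in
theorem pderiv_parts_aux (n : ℕ) (i : Fin n) (f g : EuclideanSpace ℝ (Fin n) → ℝ)
    (hf : ContDiff ℝ 1 f) (hg : ContDiff ℝ 1 g) (hc : HasCompactSupport f) :
    ∫ x, f x * pderiv' n i g x = - ∫ x, pderiv' n i f x * g x := by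
  have hf' : Continuous (pderiv' n i f) :=
    (pderiv_contDiff_aux n i f 0 1 (by exact_mod_cast hf) (by norm_num)).continuous
  have hg' : Continuous (pderiv' n i g) :=
    (pderiv_contDiff_aux n i g 0 1 (by exact_mod_cast hg) (by norm_num)).continuous
  apply integral_mul_fderiv_eq_neg_fderiv_mul_of_integrable
  · exact (hf'.mul hg.continuous).integrable_of_hasCompactSupport
      ((pderiv_supp_aux n i f hc).mul_right)
  · exact (hf.continuous.mul hg').integrable_of_hasCompactSupport hc.mul_right
  · exact (hf.continuous.mul hg.continuous).integrable_of_hasCompactSupport hc.mul_right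
  · exact fun x _ => hf.differentiable (by norm_num) x
  · exact fun x _ => hg.differentiable (by norm_num) x

theorem mixed_second_derivatives_integral (n : ℕ) (hn : 1 ≤ n)
    (u : EuclideanSpace ℝ (Fin n) → ℝ) (hu : ContDiff ℝ 3 u)
    (hsupp : HasCompactSupport u) (i j : Fin n) :
    ∫ x : EuclideanSpace ℝ (Fin n), (pderiv' n i (pderiv' n j u) x) ^ 2 =
      ∫ x : EuclideanSpace ℝ (Fin n),
        (pderiv' n i (pderiv' n i u) x) * (pderiv' n j (pderiv' n j u) x) := by
  have h2 : ∀ a, ContDiff ℝ 2 (pderiv' n a u) := fun a => by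
    exact_mod_cast pderiv_contDiff_aux n a u 2 3 (by exact_mod_cast hu) (by norm_num)
  have h1 : ∀ a b, ContDiff ℝ 1 (pderiv' n a (pderiv' n b u)) := fun a b => by
    exact_mod_cast pderiv_contDiff_aux n a _ 1 2 (by exact_mod_cast h2 b) (by norm_num)
  have hc : ∀ a b, HasCompactSupport (pderiv' n a (pderiv' n b u)) := fun a b =>
    pderiv_supp_aux n a _ (pderiv_supp_aux n b u hsupp)
  have hu2 : ContDiff ℝ 2 u := hu.of_le (by norm_num)
  have e1 := pderiv_parts_aux n j (pderiv' n i (pderiv' n j u)) (pderiv' n i u) (h1 i j)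
    ((h2 i).of_le (by norm_num)) (hc i j)
  have e2 := pderiv_parts_aux n i (pderiv' n j (pderiv' n j u)) (pderiv' n i u) (h1 j j)
    ((h2 i).of_le (by norm_num)) (hc j j)
  simp only [pderiv_comm_aux n j i u hu2] at e1
  simp only [pderiv_comm_aux n j i (pderiv' n j u) (h2 j)] at e1
  have e3 : ∀ x, pderiv' n j (pderiv' n i (pderiv' n j u)) x =
    pderiv' n i (pderiv' n j (pderiv' n j u)) x := pderiv_comm_aux n j i _ (h2 j)
  simp only [sq]
  rw [e1, ← e2]
  simp only [mul_comm]
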